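/- Let φ : (0, 1/2] → (0, +∞] be continuous, decreasing, with φ(0+) = +∞, and let H : 𝕋 → [0, +∞] be subordinated to φ. Set H_A = min(H, A). For every c₀ > 0 there exists C > 0 such that (H_A * P_{1-δ})(t) ≤ C·(H(t) + 1) for every t ∈ 𝕋, whenever A ≥ φ(1/2) and δ ∈ (0, 1) satisfies: δ ≤ c₀·φ^{-1}(A) in the case where φ satisfies condition (Reg1) (θ ↦ θ·φ(θ) nondecreasing and φ(θ) ≥ c·log(1/θ)), respectively δ ≤ c₀/A in the case where φ satisfies condition (Reg2) (φ(θ/2) ≤ C₁·φ(θ) and φ(θ) ≥ c₁/θ). -/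

import Mathlib

open MeasureTheory Set Filter
open scoped ENNReal

noncomputable section

/-- The Poisson kernel at radius `1-δ`: `p_δ(θ) = P_{1-δ}(e^{2πiθ})`. -/
def poissonKer (δ θ : ℝ) : ℝ :=
  (1 - (1 - δ) ^ 2) / (1 - 2 * (1 - δ) * Real.cos (2 * Real.pi * θ) + (1 - δ) ^ 2)

/-- Convolution of (1-periodic) functions on ℝ: `(f * g)(τ) = ∫_{-1/2}^{1/2} f(τ-θ)g(θ) dθ`,
for `f` with values in `[0,∞]` and a real kernel `g`. -/
def convPer (f : ℝ → ℝ≥0∞) (g : ℝ → ℝ) (τ : ℝ) : ℝ≥0∞ :=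
  ∫⁻ θ in Set.Ioc (-(1/2) : ℝ) (1/2), f (τ - θ) * ENNReal.ofReal (g θ)

lemma poissonKer_le {δ θ : ℝ} (hδ : δ ∈ Ioo (0 : ℝ) 1) (hθ : |θ| ≤ 1 / 2) :
    poissonKer δ θ ≤ 4 * δ / (δ ^ 2 + θ ^ 2) := by
  obtain ⟨h0, h1⟩ := hδ
  have hcos : Real.cos (2 * Real.pi * θ) ≤ 1 - 8 * θ ^ 2 := by
    have hx : |2 * Real.pi * θ| ≤ Real.pi := by
      rw [abs_mul, abs_of_pos Real.two_pi_pos]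
      nlinarith [Real.pi_pos]
    have h := Real.cos_le_one_sub_mul_cos_sq hx
    have h' : 2 / Real.pi ^ 2 * (2 * Real.pi * θ) ^ 2 = 8 * θ ^ 2 := by
      field_simp
      ring
    linarith
  have hθ2 : θ ^ 2 ≤ 1 / 4 := by
    rw [← sq_abs]
    nlinarith [abs_nonneg θ]
  have hden : δ ^ 2 + 16 * (1 - δ) * θ ^ 2 ≤
      1 - 2 * (1 - δ) * Real.cos (2 * Real.pi * θ) + (1 - δ) ^ 2 := by
    nlinarith [mul_le_mul_of_nonneg_left hcos (sub_nonneg.2 h1.le)]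
  have hden' : (δ ^ 2 + θ ^ 2) / 2 ≤ δ ^ 2 + 16 * (1 - δ) * θ ^ 2 := by
    rcases le_total δ (1 / 2) with h | h
    · nlinarith [sq_nonneg θ, sq_nonneg δ]
    · nlinarith [sq_nonneg θ, mul_nonneg (sub_nonneg.2 h1.le) (sq_nonneg θ)]
  have hpos : 0 < δ ^ 2 + θ ^ 2 := by positivity
  rw [poissonKer, div_le_div_iff₀ (by linarith) hpos]
  have hnum : 1 - (1 - δ) ^ 2 ≤ 2 * δ := by nlinarith
  nlinarith [mul_le_mul_of_nonneg_right hnum hpos.le,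
    mul_le_mul_of_nonneg_left (hden'.trans hden) h0.le]

lemma lintegral_Ioi_div_sq {a s : ℝ} (ha : 0 ≤ a) (hs : 0 < s) :
    ∫⁻ θ in Ioi s, ENNReal.ofReal (a / θ ^ 2) = ENNReal.ofReal (a / s) := by
  have hfun : EqOn (fun θ : ℝ => a / θ ^ 2) (fun θ : ℝ => a * θ ^ (-2 : ℝ)) (Ioi s) := by
    intro θ hθ
    have : 0 < θ := hs.trans hθ
    simp only
    rw [Real.rpow_neg this.le, div_eq_mul_inv]
    norm_cast
  have hint : IntegrableOn (fun θ : ℝ => a / θ ^ 2) (Ioi s) :=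
    IntegrableOn.congr_fun ((integrableOn_Ioi_rpow_of_lt (by norm_num) hs).const_mul a)
      hfun.symm measurableSet_Ioi
  rw [← ofReal_integral_eq_lintegral_ofReal hint (Eventually.of_forall fun θ => by
    dsimp only
    positivity), setIntegral_congr_fun measurableSet_Ioi hfun, integral_const_mul,
    integral_Ioi_rpow_of_lt (by norm_num) hs]
  congr 1
  norm_num
  rw [Real.rpow_neg_one, div_eq_mul_inv]

lemma lintegral_lt_abs_div_sq_le {a s : ℝ} (ha : 0 ≤ a) (hs : 0 < s) :
    ∫⁻ θ in {θ : ℝ | s < |θ|}, ENNReal.ofReal (a / θ ^ 2) ≤ ENNReal.ofReal (2 * a / s) := by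
  have hset : {θ : ℝ | s < |θ|} = Ioi s ∪ (fun θ => -θ) ⁻¹' Ioi s := by
    ext θ
    simp [lt_abs, lt_neg]
  have hneg := (Measure.measurePreserving_neg (volume : Measure ℝ)).setLIntegral_comp_preimage
    (measurableSet_Ioi (a := s)) (f := fun θ => ENNReal.ofReal (a / θ ^ 2)) (by fun_prop)
  simp only [neg_sq] at hneg
  rw [hset]
  refine (lintegral_union_le _ _ _).trans ?_
  rw [hneg, lintegral_Ioi_div_sq ha hs, ← ENNReal.ofReal_add (by positivity) (by positivity)]
  apply le_of_eq
  congr 1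
  ring

lemma lintegral_poissonKer_tail_le {δ s : ℝ} (hδ : δ ∈ Ioo (0 : ℝ) 1) (hs : 0 < s) :
    ∫⁻ θ in Ioc (-(1/2) : ℝ) (1/2) ∩ {θ : ℝ | s < |θ|}, ENNReal.ofReal (poissonKer δ θ) ≤
      ENNReal.ofReal (8 * δ / s) := by
  calc
    _ ≤ ∫⁻ θ in Ioc (-(1/2) : ℝ) (1/2) ∩ {θ : ℝ | s < |θ|},
        ENNReal.ofReal (4 * δ / θ ^ 2) := by
      refine setLIntegral_mono (by fun_prop) fun θ hθ => ENNReal.ofReal_le_ofReal ?_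
      have hθ0 : 0 < |θ| := hs.trans hθ.2
      have hθ2 : 0 < θ ^ 2 := by
        rw [← sq_abs]
        positivity
      refine (poissonKer_le hδ (abs_le.2 ⟨hθ.1.1.le, hθ.1.2⟩)).trans ?_
      have := hδ.1
      gcongr
      nlinarith
    _ ≤ ∫⁻ θ in {θ : ℝ | s < |θ|}, ENNReal.ofReal (4 * δ / θ ^ 2) :=
      lintegral_mono_set inter_subset_right
    _ ≤ ENNReal.ofReal (2 * (4 * δ) / s) :=
      lintegral_lt_abs_div_sq_le (mul_nonneg (by norm_num) hδ.1.le) hs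
    _ = _ := by
      congr 1
      ring

lemma lintegral_poissonKer_le {δ : ℝ} (hδ : δ ∈ Ioo (0 : ℝ) 1) :
    ∫⁻ θ in Ioc (-(1/2) : ℝ) (1/2), ENNReal.ofReal (poissonKer δ θ) ≤ 16 := by
  have hδ0 := hδ.1
  have hmeas : MeasurableSet {θ : ℝ | δ < |θ|} := measurableSet_lt (by fun_prop) (by fun_prop)
  rw [← lintegral_inter_add_sdiff _ _ hmeas]
  have hnear : ∫⁻ θ in Ioc (-(1/2) : ℝ) (1/2) \ {θ : ℝ | δ < |θ|},
      ENNReal.ofReal (poissonKer δ θ) ≤ 8 := by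
    calc
      _ ≤ ∫⁻ θ in Ioc (-(1/2) : ℝ) (1/2) \ {θ : ℝ | δ < |θ|}, ENNReal.ofReal (4 / δ) := by
        refine setLIntegral_mono (by fun_prop) fun θ hθ => ENNReal.ofReal_le_ofReal ?_
        refine (poissonKer_le hδ (abs_le.2 ⟨hθ.1.1.le, hθ.1.2⟩)).trans ?_
        rw [div_le_div_iff₀ (by positivity) hδ0]
        nlinarith [sq_nonneg θ]
      _ ≤ ∫⁻ θ in Icc (-δ) δ, ENNReal.ofReal (4 / δ) :=
        lintegral_mono_set fun θ hθ => abs_le.1 (not_lt.1 hθ.2)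
      _ = 8 := by
        rw [setLIntegral_const, Real.volume_Icc, ← ENNReal.ofReal_mul (by positivity)]
        have : 4 / δ * (δ - -δ) = 8 := by
          field_simp
          norm_num
        rw [this]
        norm_num
  have hfar := lintegral_poissonKer_tail_le hδ hδ0
  have h8 : ENNReal.ofReal (8 * δ / δ) = 8 := by
    rw [mul_div_cancel_right₀ _ hδ0.ne']
    norm_num
  rw [h8] at hfar
  exact (add_le_add hfar hnear).trans (by norm_num)

lemma convPer_poissonKer_le_of_le {f : ℝ → ℝ≥0∞} {M : ℝ≥0∞} {δ τ : ℝ}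
    (hδ : δ ∈ Ioo (0 : ℝ) 1) (hM : ∀ x, f x ≤ M) :
    convPer f (poissonKer δ) τ ≤ 16 * M := by
  have hmeas : Measurable (poissonKer δ) := by
    unfold poissonKer
    fun_prop
  calc
    _ ≤ ∫⁻ θ in Ioc (-(1/2) : ℝ) (1/2), M * ENNReal.ofReal (poissonKer δ θ) :=
      lintegral_mono fun θ => mul_le_mul_left (hM _) _
    _ ≤ _ := by
      rw [lintegral_const_mul _ (by fun_prop), mul_comm]
      exact mul_le_mul_left (lintegral_poissonKer_le hδ) _

lemma convPer_poissonKer_le {f : ℝ → ℝ≥0∞} {M B : ℝ≥0∞} {δ s τ : ℝ}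
    (hδ : δ ∈ Ioo (0 : ℝ) 1) (hs : 0 < s) (hB : ∀ x, f x ≤ B)
    (hM : ∀ θ : ℝ, |θ| ≤ 1 / 2 → |θ| ≤ s → f (τ - θ) ≤ M) :
    convPer f (poissonKer δ) τ ≤ 16 * M + B * ENNReal.ofReal (8 * δ / s) := by
  have hmeas : Measurable (poissonKer δ) := by
    unfold poissonKer
    fun_prop
  have hset : MeasurableSet {θ : ℝ | s < |θ|} := measurableSet_lt (by fun_prop) (by fun_prop)
  rw [convPer, ← lintegral_inter_add_sdiff _ _ hset, add_comm]
  refine add_le_add ?_ ?_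
  · calc
      _ ≤ ∫⁻ θ in Ioc (-(1/2) : ℝ) (1/2) \ {θ : ℝ | s < |θ|},
          M * ENNReal.ofReal (poissonKer δ θ) :=
        setLIntegral_mono (by fun_prop) fun θ hθ => mul_le_mul_left
          (hM θ (abs_le.2 ⟨hθ.1.1.le, hθ.1.2⟩) (not_lt.1 hθ.2)) _
      _ ≤ ∫⁻ θ in Ioc (-(1/2) : ℝ) (1/2), M * ENNReal.ofReal (poissonKer δ θ) :=
        lintegral_mono_set sdiff_subset
      _ ≤ _ := by
        rw [lintegral_const_mul _ (by fun_prop), mul_comm]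
        exact mul_le_mul_left (lintegral_poissonKer_le hδ) _
  · calc
      _ ≤ ∫⁻ θ in Ioc (-(1/2) : ℝ) (1/2) ∩ {θ : ℝ | s < |θ|},
          B * ENNReal.ofReal (poissonKer δ θ) :=
        lintegral_mono fun θ => mul_le_mul_left (hB _) _
      _ ≤ _ := by
        rw [lintegral_const_mul _ (by fun_prop)]
        exact mul_le_mul_right (lintegral_poissonKer_tail_le hδ hs) _

lemma abs_sub_le_of_periodic_of_lipschitzOnWith {g : ℝ → ℝ} (hper : Function.Periodic g 1)
    (hg : LipschitzOnWith 1 g (Icc (-(1/2)) (1/2))) {x y : ℝ} (hxy : |x - y| ≤ 1) :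
    |g x - g y| ≤ |x - y| := by
  wlog hle : x ≤ y generalizing x y
  · rw [abs_sub_comm, abs_sub_comm x]
    exact this (by rwa [abs_sub_comm]) (le_of_not_ge hle)
  have hg' : ∀ u ∈ Icc (-(1/2) : ℝ) (1/2), ∀ v ∈ Icc (-(1/2) : ℝ) (1/2), u ≤ v →
      |g u - g v| ≤ v - u := by
    intro u hu v hv huv
    have := hg.dist_le_mul u hu v hv
    rwa [Real.dist_eq, Real.dist_eq, NNReal.coe_one, one_mul, abs_sub_comm u,
      abs_of_nonneg (sub_nonneg.2 huv)] at this
  rw [abs_sub_comm x, abs_of_nonneg (sub_nonneg.2 hle)] at hxy ⊢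
  set n : ℤ := ⌊x + 1 / 2⌋
  have hn1 : (n : ℝ) ≤ x + 1 / 2 := Int.floor_le _
  have hn2 : x + 1 / 2 < n + 1 := Int.lt_floor_add_one _
  have hshift : ∀ z, g (z - n) = g z := fun z => by simpa using hper.sub_int_mul_eq (x := z) n
  rw [← hshift x, ← hshift y]
  rcases le_total (y - n) (1 / 2) with h | h
  · have := hg' (x - n) ⟨by linarith, by linarith⟩ (y - n) ⟨by linarith, h⟩ (by linarith)
    linarith
  · have h1 := hg' (x - n) ⟨by linarith, by linarith⟩ (1 / 2) ⟨by norm_num, le_rfl⟩ (by linarith)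
    have h2 := hg' (-(1 / 2)) ⟨le_rfl, by norm_num⟩ (y - n - 1) ⟨by linarith, by linarith⟩
      (by linarith)
    have h3 : g (-(1 / 2)) = g (1 / 2) := by
      rw [← hper (-(1 / 2))]
      norm_num
    rw [hper.sub_eq, h3] at h2
    have := abs_sub_le (g (x - n)) (g (1 / 2)) (g (y - n))
    linarith

lemma exists_eq_of_tendsto_top {φ : ℝ → ℝ≥0∞} (hφcont : ContinuousOn φ (Ioc 0 (1/2)))
    (hφtop : Tendsto φ (nhdsWithin 0 (Ioi 0)) (nhds ⊤)) {y : ℝ≥0∞} (hy : φ (1/2) ≤ y)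
    (hy' : y ≠ ⊤) : ∃ θ ∈ Ioc (0 : ℝ) (1/2), φ θ = y := by
  obtain ⟨b, hb, hb0, hb2⟩ := ((hφtop.eventually (lt_mem_nhds hy'.lt_top)).and
    (Ioo_mem_nhdsGT (show (0 : ℝ) < 1 / 2 by norm_num))).exists
  obtain ⟨θ, hθ, rfl⟩ := intermediate_value_Icc' hb2.le
    (hφcont.mono fun z hz => ⟨hb0.trans_le hz.1, hz.2⟩) ⟨hy, hb.le⟩
  exact ⟨θ, ⟨hb0.trans_le hθ.1, hθ.2⟩, rfl⟩

/-- The Poisson integral of `H_A` for `H` subordinated to a regular `φ`: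
for every `c₀ > 0` there is `C > 0` such that `(H_A * P_{1-δ})(t) ≤ C(H(t)+1)` on `𝕋`,
whenever `A ≥ φ(1/2)` and either `φ` satisfies (Reg1) and `δ ≤ c₀·φ⁻¹(A)`, or `φ`
satisfies (Reg2) and `δ ≤ c₀/A`. -/
theorem statement12
    (φ : ℝ → ℝ≥0∞) (ψ : ℝ≥0∞ → ℝ)
    -- φ : (0,1/2] → (0,∞] is continuous, (strictly) decreasing, with φ(0+) = ∞
    (hφcont : ContinuousOn φ (Set.Ioc 0 (1/2)))
    (hφanti : StrictAntiOn φ (Set.Ioc 0 (1/2)))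
    (hφpos : ∀ θ ∈ Set.Ioc (0:ℝ) (1/2), 0 < φ θ)
    (hφtop : Tendsto φ (nhdsWithin 0 (Set.Ioi 0)) (nhds ⊤))
    -- ψ = φ⁻¹ : the (generalized) inverse of φ, with φ⁻¹(∞) = 0
    (hψφ : ∀ θ ∈ Set.Ioc (0:ℝ) (1/2), ψ (φ θ) = θ)
    (hψmem : ∀ y : ℝ≥0∞, φ (1/2) ≤ y → ψ y ∈ Set.Icc (0:ℝ) (1/2))
    (hφψ : ∀ y : ℝ≥0∞, φ (1/2) ≤ y → y ≠ ⊤ → φ (ψ y) = y)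
    (hψtop : ψ ⊤ = 0)
    -- H : 𝕋 → [0,∞] with φ(1/2) ≤ inf H, subordinated to φ:
    -- θ ↦ φ⁻¹(H(e^{2πiθ})) is nonnegative and 1-Lipschitz on [-1/2,1/2]
    (H : AddCircle (1:ℝ) → ℝ≥0∞) (hHmeas : Measurable H)
    (hinf : ∀ t : AddCircle (1:ℝ), φ (1/2) ≤ H t)
    (hsubnn : ∀ t : AddCircle (1:ℝ), 0 ≤ ψ (H t))
    (hsub : LipschitzOnWith 1 (fun θ : ℝ => ψ (H ((θ : ℝ) : AddCircle (1:ℝ))))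
      (Set.Icc (-(1/2)) (1/2)))
    (c₀ : ℝ) (hc₀ : 0 < c₀) :
    ∃ C : ℝ, 0 < C ∧ ∀ A δ : ℝ, φ (1/2) ≤ ENNReal.ofReal A → δ ∈ Set.Ioo (0:ℝ) 1 →
      (((MonotoneOn (fun θ : ℝ => ENNReal.ofReal θ * φ θ) (Set.Ioc 0 (1/2)) ∧
          ∃ c : ℝ, 0 < c ∧ ∀ θ ∈ Set.Ioc (0:ℝ) (1/2),
            ENNReal.ofReal (c * Real.log (1/θ)) ≤ φ θ) ∧
          δ ≤ c₀ * ψ (ENNReal.ofReal A)) ∨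
        (((∃ C₁ : ℝ, 0 < C₁ ∧ ∀ θ ∈ Set.Ioc (0:ℝ) (1/2),
            φ (θ/2) ≤ ENNReal.ofReal C₁ * φ θ) ∧
          ∃ c₁ : ℝ, 0 < c₁ ∧ ∀ θ ∈ Set.Ioc (0:ℝ) (1/2), ENNReal.ofReal (c₁ / θ) ≤ φ θ) ∧
          δ ≤ c₀ / A)) →
      ∀ τ : ℝ, convPer (fun θ : ℝ => min (H ((θ : ℝ) : AddCircle (1:ℝ))) (ENNReal.ofReal A))
          (poissonKer δ) τ
        ≤ ENNReal.ofReal C * (H ((τ : ℝ) : AddCircle (1:ℝ)) + 1) := by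
  have hhalf : (1 / 2 : ℝ) ∈ Ioc (0 : ℝ) (1 / 2) := by norm_num
  have hfin : ∀ θ ∈ Ioc (0 : ℝ) (1 / 2), φ θ ≠ ⊤ := fun θ hθ =>
    ((hφanti ⟨half_pos hθ.1, (half_le_self hθ.1.le).trans hθ.2⟩ hθ (half_lt_self hθ.1)).trans_le
      le_top).ne
  have hF : ∀ θ ∈ Ioc (0 : ℝ) (1 / 2), ∃ F : ℝ, 0 < F ∧ φ θ = ENNReal.ofReal F := fun θ hθ =>
    ⟨(φ θ).toReal, ENNReal.toReal_pos (hφpos θ hθ).ne' (hfin θ hθ),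
      (ENNReal.ofReal_toReal (hfin θ hθ)).symm⟩
  have hper : Function.Periodic (fun θ : ℝ => ψ (H (θ : AddCircle (1 : ℝ)))) 1 := by
    intro x
    simp
  -- `H` near a point where it is finite
  have hnear : ∀ τ h : ℝ, h ∈ Ioc (0 : ℝ) (1 / 2) → H (τ : AddCircle (1 : ℝ)) = φ h →
      ∀ θ : ℝ, |θ| ≤ 1 / 2 → |θ| ≤ h / 2 →
        H ((τ - θ : ℝ) : AddCircle (1 : ℝ)) ≤ φ (h / 2) := by
    intro τ h hh hτ θ hθ hθh
    have hlip := abs_sub_le_of_periodic_of_lipschitzOnWith hper hsub (x := τ) (y := τ - θ)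
      (by rw [sub_sub_cancel]; linarith)
    simp only [sub_sub_cancel, hτ, hψφ h hh] at hlip
    have hge : h / 2 ≤ ψ (H ((τ - θ : ℝ) : AddCircle (1 : ℝ))) := by
      linarith [(abs_le.1 hlip).2]
    have hpos : 0 < h / 2 := half_pos hh.1
    have hne : H ((τ - θ : ℝ) : AddCircle (1 : ℝ)) ≠ ⊤ := by
      intro htop
      rw [htop, hψtop] at hge
      linarith
    obtain ⟨k, hk, hkeq⟩ := exists_eq_of_tendsto_top hφcont hφtop (hinf _) hne
    rw [← hkeq, hψφ k hk] at hge
    rw [← hkeq]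
    exact hφanti.antitoneOn ⟨hpos, hge.trans hk.2⟩ hk hge
  -- the doubling estimate near the point and the bound `A` far from it
  have hconv : ∀ (τ h F D A δ : ℝ), h ∈ Ioc (0 : ℝ) (1 / 2) →
      H (τ : AddCircle (1 : ℝ)) = φ h → 0 < F → φ h = ENNReal.ofReal F → 0 < D →
      φ (h / 2) ≤ ENNReal.ofReal (D * F) → 0 < A → δ ∈ Ioo (0 : ℝ) 1 →
      convPer (fun θ : ℝ => min (H (θ : AddCircle (1 : ℝ))) (ENNReal.ofReal A))
        (poissonKer δ) τ ≤ ENNReal.ofReal (16 * D * F + 16 * (A * δ / h)) := by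
    intro τ h F D A δ hh hτ hF0 hFφ hD hdouble hA hδ
    have hh0 := hh.1
    have hδ0 := hδ.1
    refine (convPer_poissonKer_le hδ (half_pos hh0) (fun x => min_le_right _ _)
      fun θ h1 h2 => (min_le_left _ _).trans ((hnear τ h hh hτ θ h1 h2).trans hdouble)).trans ?_
    rw [← ENNReal.ofReal_mul hA.le, show (16 : ℝ≥0∞) = ENNReal.ofReal 16 by norm_num,
      ← ENNReal.ofReal_mul (by norm_num), ← ENNReal.ofReal_add (by positivity) (by positivity)]
    apply le_of_eq
    congr 1
    field_simp
    ring
  have hfinish : ∀ (F C C' : ℝ) (X : ℝ≥0∞), 0 < F → 0 < C' → X ≤ ENNReal.ofReal (C' * F) → C' ≤ C →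
      X ≤ ENNReal.ofReal C * (ENNReal.ofReal F + 1) := by
    intro F C C' X hF0 hC' hX hC
    refine hX.trans ?_
    rw [ENNReal.ofReal_mul hC'.le]
    exact mul_le_mul' (ENNReal.ofReal_le_ofReal hC) le_self_add
  obtain ⟨K, hK0, hK⟩ : ∃ K : ℝ, 0 < K ∧ (((∃ C₁ : ℝ, 0 < C₁ ∧ ∀ θ ∈ Ioc (0:ℝ) (1/2),
            φ (θ/2) ≤ ENNReal.ofReal C₁ * φ θ) ∧
          ∃ c₁ : ℝ, 0 < c₁ ∧ ∀ θ ∈ Ioc (0:ℝ) (1/2), ENNReal.ofReal (c₁ / θ) ≤ φ θ) →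
      ∃ C₁ c₁ : ℝ, 0 < C₁ ∧ 0 < c₁ ∧ 16 * C₁ + 16 * (c₀ / c₁) ≤ K ∧
        (∀ θ ∈ Ioc (0:ℝ) (1/2), φ (θ/2) ≤ ENNReal.ofReal C₁ * φ θ) ∧
        ∀ θ ∈ Ioc (0:ℝ) (1/2), ENNReal.ofReal (c₁ / θ) ≤ φ θ) := by
    by_cases hreg : ((∃ C₁ : ℝ, 0 < C₁ ∧ ∀ θ ∈ Ioc (0:ℝ) (1/2),
            φ (θ/2) ≤ ENNReal.ofReal C₁ * φ θ) ∧
          ∃ c₁ : ℝ, 0 < c₁ ∧ ∀ θ ∈ Ioc (0:ℝ) (1/2), ENNReal.ofReal (c₁ / θ) ≤ φ θ)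
    · obtain ⟨⟨C₁, hC₁, h1⟩, c₁, hc₁, h2⟩ := hreg
      exact ⟨16 * C₁ + 16 * (c₀ / c₁), by positivity,
        fun _ => ⟨C₁, c₁, hC₁, hc₁, le_rfl, h1, h2⟩⟩
    · exact ⟨1, one_pos, fun h => absurd h hreg⟩
  refine ⟨32 + 16 * c₀ + K, by positivity, fun A δ hA hδ hcase τ => ?_⟩
  have hA0 : 0 < A := ENNReal.ofReal_pos.1 ((hφpos _ hhalf).trans_le hA)
  by_cases hτtop : H (τ : AddCircle (1 : ℝ)) = ⊤
  · rw [hτtop, top_add, ENNReal.mul_top (ENNReal.ofReal_pos.2 (by positivity)).ne']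
    exact le_top
  obtain ⟨h, hh, hhτ⟩ := exists_eq_of_tendsto_top hφcont hφtop (hinf τ) hτtop
  obtain ⟨F, hF0, hFh⟩ := hF h hh
  have hh0 := hh.1
  rw [← hhτ, hFh]
  rcases hcase with ⟨⟨hmono, -⟩, hδA⟩ | ⟨hreg, hδA⟩
  · obtain ⟨a, ha, haA⟩ := exists_eq_of_tendsto_top hφcont hφtop hA ENNReal.ofReal_ne_top
    rw [← haA, hψφ a ha] at hδA
    rcases le_or_gt a h with hah | hah
    · have hhalfh : h / 2 ∈ Ioc (0 : ℝ) (1 / 2) :=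
        ⟨half_pos hh0, (half_le_self hh0.le).trans hh.2⟩
      obtain ⟨G, hG0, hG⟩ := hF _ hhalfh
      have h1 := hmono hhalfh hh (half_le_self hh0.le)
      simp only [hG, hFh] at h1
      rw [← ENNReal.ofReal_mul hhalfh.1.le, ← ENNReal.ofReal_mul hh0.le,
        ENNReal.ofReal_le_ofReal_iff (by positivity)] at h1
      have hGF : G ≤ 2 * F := by
        by_contra! hlt
        nlinarith
      have h2 := hmono ha hh hah
      simp only [haA, hFh] at h2
      rw [← ENNReal.ofReal_mul ha.1.le, ← ENNReal.ofReal_mul hh0.le,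
        ENNReal.ofReal_le_ofReal_iff (by positivity)] at h2
      have h3 : A * δ / h ≤ c₀ * F := by
        rw [div_le_iff₀ hh0]
        nlinarith [mul_le_mul_of_nonneg_left hδA hA0.le, mul_le_mul_of_nonneg_left h2 hc₀.le]
      refine hfinish F _ (32 + 16 * c₀) _ hF0 (by positivity)
        ((hconv τ h F 2 A δ hh hhτ.symm hF0 hFh two_pos
          (hG.le.trans (ENNReal.ofReal_le_ofReal hGF)) hA0 hδ).trans
          (ENNReal.ofReal_le_ofReal ?_)) (by linarith)
      linarith
    · have hle : ENNReal.ofReal A ≤ ENNReal.ofReal F := by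
        rw [← haA, ← hFh]
        exact hφanti.antitoneOn hh ha hah.le
      refine hfinish F _ 16 _ hF0 (by norm_num) ((convPer_poissonKer_le_of_le hδ
        fun x => (min_le_right _ _).trans hle).trans (le_of_eq ?_)) (by linarith)
      rw [ENNReal.ofReal_mul (by norm_num)]
      norm_num
  · obtain ⟨C₁, c₁, hC₁, hc₁, hCK, hdouble, hlow⟩ := hK hreg
    have h1 := hdouble h hh
    rw [hFh, ← ENNReal.ofReal_mul hC₁.le] at h1
    have h2 := hlow h hh
    rw [hFh, ENNReal.ofReal_le_ofReal_iff hF0.le] at h2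
    have h3 : A * δ / h ≤ c₀ / c₁ * F := by
      rw [le_div_iff₀ hA0] at hδA
      calc
        A * δ / h ≤ c₀ / h := by
          gcongr
          linarith
        _ = c₀ / c₁ * (c₁ / h) := by field_simp
        _ ≤ _ := by gcongr
    refine hfinish F _ (16 * C₁ + 16 * (c₀ / c₁)) _ hF0 (by positivity)
      ((hconv τ h F C₁ A δ hh hhτ.symm hF0 hFh hC₁ h1 hA0 hδ).trans
        (ENNReal.ofReal_le_ofReal ?_)) (by linarith)
    linarith
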